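/- The F-dimension of the center Z(T) of the Terwilliger F-algebra T of the factorial scheme with parameters u_1,…,u_n equals 2^{n₂}, where n₂ = |{a : u_a > 2}|. In particular, this dimension is independent of the field F. -/

import Mathlib

open Finset

variable {n : ℕ} {U : Fin n → Type*} [∀ i, Fintype (U i)] [∀ i, DecidableEq (U i)]
variable (F : Type*) [Field F]

/-- `D(y,z) = {i : y i ≠ z i}`. -/
def Dst (y z : ∀ i, U i) : Finset (Fin n) := univ.filter (fun i => y i ≠ z i)

/-- Adjacency matrix of the relation indexed by `S`. -/
def adjMat (S : Finset (Fin n)) : Matrix (∀ i, U i) (∀ i, U i) F :=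
  fun y z => if Dst y z = S then 1 else 0

/-- Dual idempotent with respect to the base point `x`. -/
def dualIdem (x : ∀ i, U i) (S : Finset (Fin n)) : Matrix (∀ i, U i) (∀ i, U i) F :=
  Matrix.diagonal (fun y => if Dst x y = S then 1 else 0)

/-- The Terwilliger `F`-algebra of the factorial scheme with base point `x`. -/
def TerwAlg (x : ∀ i, U i) : Subalgebra F (Matrix (∀ i, U i) (∀ i, U i) F) :=
  Algebra.adjoin F (Set.range (adjMat F) ∪ Set.range (dualIdem F x))

theorem mem_Dst' {n : ℕ} {U : Fin n → Type*} [∀ i, DecidableEq (U i)]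
    (y z : ∀ i, U i) (i : Fin n) : i ∈ Dst y z ↔ y i ≠ z i := by
  simp [Dst]

theorem exists_perm_triple {V : Type*} [DecidableEq V] (x y z y' z' : V)
    (h1 : x = y ↔ x = y') (h2 : x = z ↔ x = z') (h3 : y = z ↔ y' = z') :
    ∃ s : Equiv.Perm V, s x = x ∧ s y = y' ∧ s z = z' := by
  have hx : Equiv.swap y y' x = x := by
    by_cases h : x = y
    · have := h1.1 h
      subst h; subst this; simp
    · exact Equiv.swap_apply_of_ne_of_ne h (fun h' => h (h1.2 h'))
  refine ⟨(Equiv.swap y y').trans (Equiv.swap (Equiv.swap y y' z) z'), ?_, ?_, ?_⟩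
  · rw [Equiv.trans_apply, hx]
    by_cases h : x = z
    · have := h2.1 h
      rw [← h, hx, ← this]; simp
    · apply Equiv.swap_apply_of_ne_of_ne
      · intro h'
        apply h
        apply (Equiv.swap y y').injective
        rw [hx, ← h']
      · exact fun h' => h (h2.2 h')
  · rw [Equiv.trans_apply, Equiv.swap_apply_left]
    by_cases h : y = z
    · have := h3.1 h
      rw [← h, Equiv.swap_apply_left, ← this]; simp
    · apply Equiv.swap_apply_of_ne_of_ne
      · intro h'
        apply h
        apply (Equiv.swap y y').injective
        rw [← h', Equiv.swap_apply_left]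
      · exact fun h' => h (h3.2 h')
  · simp

/-- entries depend only on the triple of difference sets -/
def InB (F : Type*) {n : ℕ} {U : Fin n → Type*} [∀ i, DecidableEq (U i)]
    (x : ∀ i, U i) (M : Matrix (∀ i, U i) (∀ i, U i) F) : Prop :=
  ∀ y z y' z', Dst x y = Dst x y' → Dst x z = Dst x z' → Dst y z = Dst y' z' → M y z = M y' z'

theorem Dst_iff {n : ℕ} {U : Fin n → Type*} [∀ i, DecidableEq (U i)]
    {y z y' z' : ∀ i, U i} (h : Dst y z = Dst y' z') (i : Fin n) : y i = z i ↔ y' i = z' i := by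
  have := congrArg (fun s => i ∈ s) h
  simp only [mem_Dst', eq_iff_iff] at this
  exact not_iff_not.1 this

theorem InB_mul (F : Type*) [Field F] {n : ℕ} {U : Fin n → Type*} [∀ i, Fintype (U i)]
    [∀ i, DecidableEq (U i)]
    (x : ∀ i, U i) (M N : Matrix (∀ i, U i) (∀ i, U i) F) (hM : InB F x M) (hN : InB F x N) :
    InB F x (M * N) := by
  intro y z y' z' h1 h2 h3
  choose s hs1 hs2 hs3 using fun i => exists_perm_triple (x i) (y i) (z i) (y' i) (z' i)
    (Dst_iff h1 i) (Dst_iff h2 i) (Dst_iff h3 i)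
  rw [Matrix.mul_apply, Matrix.mul_apply]
  refine Fintype.sum_equiv (Equiv.piCongrRight s) _ _ ?_
  intro w
  have e1 : Dst x w = Dst x (Equiv.piCongrRight s w) := by
    ext i
    have e : (s i (x i) = s i (w i)) ↔ x i = w i := (s i).apply_eq_iff_eq
    rw [hs1 i] at e
    rw [mem_Dst', mem_Dst']
    exact (not_congr e).symm
  congr 1
  · apply hM _ _ _ _ h1 e1
    ext i
    rw [mem_Dst', mem_Dst', ← hs2 i]
    simp
  · apply hN _ _ _ _ e1 h2
    ext i
    rw [mem_Dst', mem_Dst', ← hs3 i]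
    simp

theorem InB_of_mem (F : Type*) [Field F] {n : ℕ} {U : Fin n → Type*} [∀ i, Fintype (U i)]
    [∀ i, DecidableEq (U i)]
    (x : ∀ i, U i) (M : Matrix (∀ i, U i) (∀ i, U i) F) (hM : M ∈ TerwAlg F x) : InB F x M := by
  have hdiag : ∀ y z y' z' : (∀ i, U i), Dst y z = Dst y' z' → (y = z ↔ y' = z') := by
    intro y z y' z' h
    rw [funext_iff, funext_iff]
    exact forall_congr' (Dst_iff h)
  unfold TerwAlg at hM
  induction hM using Algebra.adjoin_induction with
  | mem M hM =>
    rcases hM with ⟨S, rfl⟩ | ⟨S, rfl⟩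
    · intro y z y' z' h1 h2 h3
      simp only [adjMat, h3]
    · intro y z y' z' h1 h2 h3
      simp only [dualIdem, Matrix.diagonal_apply, h1, hdiag _ _ _ _ h3]
  | algebraMap r =>
    intro y z y' z' h1 h2 h3
    simp only [Matrix.algebraMap_matrix_apply, hdiag _ _ _ _ h3]
  | add M N _ _ hM hN =>
    intro y z y' z' h1 h2 h3
    rw [Matrix.add_apply, Matrix.add_apply, hM _ _ _ _ h1 h2 h3, hN _ _ _ _ h1 h2 h3]
  | mul M N _ _ hM hN => exact InB_mul F x M N hM hN

theorem mem_of_InB (F : Type*) [Field F] {n : ℕ} {U : Fin n → Type*} [∀ i, Fintype (U i)]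
    [∀ i, DecidableEq (U i)]
    (x : ∀ i, U i) (M : Matrix (∀ i, U i) (∀ i, U i) F) (hM : InB F x M) : M ∈ TerwAlg F x := by
  classical
  let c : Finset (Fin n) → Finset (Fin n) → Finset (Fin n) → F := fun R S T =>
    if h : ∃ p : (∀ i, U i) × (∀ i, U i), Dst x p.1 = R ∧ Dst p.1 p.2 = S ∧ Dst x p.2 = T then
      M h.choose.1 h.choose.2 else 0
  have hc : ∀ y z, c (Dst x y) (Dst y z) (Dst x z) = M y z := by
    intro y z
    have h : ∃ p : (∀ i, U i) × (∀ i, U i), Dst x p.1 = Dst x y ∧ Dst p.1 p.2 = Dst y z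
      ∧ Dst x p.2 = Dst x z := ⟨(y, z), rfl, rfl, rfl⟩
    simp only [c]
    rw [dif_pos h]
    exact hM _ _ _ _ h.choose_spec.1 h.choose_spec.2.2 h.choose_spec.2.1
  have key : M = ∑ R, ∑ S, ∑ T, c R S T • (dualIdem F x R * adjMat F S * dualIdem F x T) := by
    ext y z
    rw [Matrix.sum_apply]
    simp only [Matrix.sum_apply, Matrix.smul_apply, dualIdem, Matrix.mul_diagonal,
      Matrix.diagonal_mul, adjMat, smul_eq_mul]
    rw [Finset.sum_eq_single (Dst x y), Finset.sum_eq_single (Dst y z),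
      Finset.sum_eq_single (Dst x z)]
    · simp [hc]
    · intro b _ hb; simp [hb.symm]
    · simp
    · intro b _ hb; simp [hb.symm]
    · simp
    · intro b _ hb; simp [hb.symm]
    · simp
  have h1 : ∀ S, adjMat F S ∈ TerwAlg F x := fun S =>
    Algebra.subset_adjoin (Or.inl ⟨S, rfl⟩)
  have h2 : ∀ S, dualIdem F x S ∈ TerwAlg F x := fun S =>
    Algebra.subset_adjoin (Or.inr ⟨S, rfl⟩)
  rw [key]
  refine sum_mem fun R _ => sum_mem fun S _ => sum_mem fun T _ => ?_
  exact Subalgebra.smul_mem _ (mul_mem (mul_mem (h2 R) (h1 S)) (h2 T)) _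

/-- one-coordinate central element -/
def kOne (F : Type*) [Field F] {V : Type*} [Fintype V] [DecidableEq V] (x : V) : Matrix V V F :=
  fun y z => if y = x ∧ z = x then ((Fintype.card V : F) - 2)
    else if y ≠ x ∧ z ≠ x ∧ y ≠ z then 1 else 0

theorem kOne_row (F : Type*) [Field F] {V : Type*} [Fintype V] [DecidableEq V] (x y : V) :
    ∑ z, kOne F x y z = (Fintype.card V : F) - 2 := by
  unfold kOne
  by_cases h : y = x
  · subst h
    simp
  · have : ∀ z, (if y = x ∧ z = x then ((Fintype.card V : F) - 2)
        else if y ≠ x ∧ z ≠ x ∧ y ≠ z then 1 else 0)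
        = 1 - (if z = x then 1 else 0) - (if z = y then 1 else 0) := by
      intro z
      by_cases h1 : z = x
      · subst h1
        simp [h, Ne.symm h]
      · by_cases h2 : z = y
        · subst h2; simp [h]
        · simp [h, h1, h2, Ne.symm h2]
    simp only [this]
    rw [Finset.sum_sub_distrib, Finset.sum_sub_distrib]
    simp
    ring

theorem kOne_symm (F : Type*) [Field F] {V : Type*} [Fintype V] [DecidableEq V] (x y z : V) :
    kOne F x y z = kOne F x z y := by
  unfold kOne
  simp only [and_comm (a := y = x), ne_comm (a := y) (b := z)]
  congr 2
  apply propext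
  tauto

theorem kOne_comm_adj (F : Type*) [Field F] {V : Type*} [Fintype V] [DecidableEq V] (x y z : V) :
    ∑ w, kOne F x y w * (if w ≠ z then 1 else 0) = ∑ w, (if y ≠ w then 1 else 0) * kOne F x w z := by
  have e1 : ∀ w, kOne F x y w * (if w ≠ z then 1 else 0)
      = kOne F x y w - (if w = z then kOne F x y w else 0) := by
    intro w; by_cases h : w = z <;> simp [h]
  have e2 : ∀ w, (if y ≠ w then 1 else 0) * kOne F x w z
      = kOne F x z w - (if y = w then kOne F x w z else 0) := by
    intro w; rw [kOne_symm F x z w]; by_cases h : y = w <;> simp [h]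
  simp only [e1, e2, Finset.sum_sub_distrib, kOne_row]
  simp

/-- the factors of the product matrices -/
def kS (F : Type*) [Field F] {n : ℕ} {U : Fin n → Type*} [∀ i, Fintype (U i)]
    [∀ i, DecidableEq (U i)] (x : ∀ i, U i) (S : Finset (Fin n)) (i : Fin n) :
    Matrix (U i) (U i) F := if i ∈ S then kOne F (x i) else 1

/-- product matrix -/
def prodMat (F : Type*) [Field F] {n : ℕ} {U : Fin n → Type*}
    (m : ∀ i, Matrix (U i) (U i) F) : Matrix (∀ i, U i) (∀ i, U i) F :=
  fun y z => ∏ i, m i (y i) (z i)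

theorem prodMat_mul (F : Type*) [Field F] {n : ℕ} {U : Fin n → Type*} [∀ i, Fintype (U i)]
    (m k : ∀ i, Matrix (U i) (U i) F) :
    prodMat F m * prodMat F k = prodMat F (fun i => m i * k i) := by
  classical
  ext y z
  simp only [Matrix.mul_apply, prodMat, ← Finset.prod_mul_distrib]
  rw [Finset.prod_univ_sum]
  simp

theorem prodMat_comm (F : Type*) [Field F] {n : ℕ} {U : Fin n → Type*} [∀ i, Fintype (U i)]
    (m k : ∀ i, Matrix (U i) (U i) F) (h : ∀ i, m i * k i = k i * m i) :
    prodMat F m * prodMat F k = prodMat F k * prodMat F m := by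
  rw [prodMat_mul, prodMat_mul]
  simp only [h]

/-- one-coordinate adjacency matrix -/
def adjOne (F : Type*) [Field F] (V : Type*) [DecidableEq V] : Matrix V V F :=
  fun a b => if a ≠ b then 1 else 0

theorem adjMat_eq (F : Type*) [Field F] {n : ℕ} {U : Fin n → Type*}
    [∀ i, DecidableEq (U i)] (S : Finset (Fin n)) :
    adjMat (U := U) F S = prodMat F (fun i => if i ∈ S then adjOne F (U i) else 1) := by
  ext y z
  unfold adjMat prodMat
  have : ∀ i, ((if i ∈ S then adjOne F (U i) else 1 : Matrix (U i) (U i) F) (y i) (z i)) = if (i ∈ Dst y z ↔ i ∈ S) then 1 else 0 := by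
    intro i
    simp only [mem_Dst']
    by_cases h : i ∈ S <;> simp [h, Matrix.one_apply, adjOne]
  simp only [this, Finset.prod_ite_zero, Finset.prod_const_one]
  simp only [Finset.ext_iff, mem_univ, true_imp_iff]

theorem dualIdem_eq (F : Type*) [Field F] {n : ℕ} {U : Fin n → Type*}
    [∀ i, DecidableEq (U i)] (x : ∀ i, U i) (S : Finset (Fin n)) :
    dualIdem (U := U) F x S = prodMat F (fun i =>
      Matrix.diagonal (fun a => if (x i ≠ a ↔ i ∈ S) then 1 else 0)) := by
  ext y z
  unfold dualIdem prodMat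
  simp only [Matrix.diagonal_apply]
  have : ∀ i, (if y i = z i then (if (x i ≠ y i ↔ i ∈ S) then (1 : F) else 0) else 0)
      = if (y i = z i ∧ (i ∈ Dst x y ↔ i ∈ S)) then 1 else 0 := by
    intro i
    simp only [mem_Dst', ite_and]
  simp only [this, Finset.prod_ite_zero, Finset.prod_const_one, mem_univ, true_imp_iff, ← ite_and]
  simp only [Finset.ext_iff, forall_and, funext_iff]

theorem kMat_comm_adj (F : Type*) [Field F] {n : ℕ} {U : Fin n → Type*} [∀ i, Fintype (U i)]
    [∀ i, DecidableEq (U i)] (x : ∀ i, U i) (S T : Finset (Fin n)) :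
    prodMat F (kS F x S) * adjMat F T = adjMat F T * prodMat F (kS F x S) := by
  rw [adjMat_eq]
  apply prodMat_comm
  intro i
  have h1 : kOne F (x i) * adjOne F (U i) = adjOne F (U i) * kOne F (x i) := by
    ext a b
    rw [Matrix.mul_apply, Matrix.mul_apply]
    exact kOne_comm_adj F (x i) a b
  unfold kS
  by_cases hS : i ∈ S <;> by_cases hT : i ∈ T <;> simp [hS, hT, h1]

theorem kMat_comm_dual (F : Type*) [Field F] {n : ℕ} {U : Fin n → Type*} [∀ i, Fintype (U i)]
    [∀ i, DecidableEq (U i)] (x : ∀ i, U i) (S T : Finset (Fin n)) :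
    prodMat F (kS F x S) * dualIdem F x T = dualIdem F x T * prodMat F (kS F x S) := by
  rw [dualIdem_eq]
  apply prodMat_comm
  intro i
  unfold kS
  split_ifs
  · ext a b
    rw [Matrix.mul_diagonal, Matrix.diagonal_mul]
    unfold kOne
    have hs : ∀ c : U i, (x i ≠ c) ↔ ¬ (c = x i) := fun c => ne_comm
    simp only [hs]
    by_cases ha : a = x i <;> by_cases hb : b = x i <;>
      by_cases hab : a = b <;> simp [ha, hb, hab]
  all_goals simp

theorem kMat_InB (F : Type*) [Field F] {n : ℕ} {U : Fin n → Type*} [∀ i, Fintype (U i)]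
    [∀ i, DecidableEq (U i)] (x : ∀ i, U i) (S : Finset (Fin n)) :
    InB F x (prodMat F (kS F x S)) := by
  intro y z y' z' h1 h2 h3
  unfold prodMat
  refine Finset.prod_congr rfl fun i _ => ?_
  have e1 := Dst_iff h1 i
  have e2 := Dst_iff h2 i
  have e3 := Dst_iff h3 i
  unfold kS
  split_ifs
  · unfold kOne
    simp only [ne_eq, eq_comm (b := x i), e1, e2, e3]
  · simp only [Matrix.one_apply, e3]

/-- a matrix of `T` commuting with the generators and vanishing on fully supported pairs is zero -/
theorem central_zero (F : Type*) [Field F] {n : ℕ} {U : Fin n → Type*} [∀ i, Fintype (U i)]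
    [∀ i, DecidableEq (U i)] (x a : ∀ i, U i) (ha : ∀ i, a i ≠ x i)
    (M : Matrix (∀ i, U i) (∀ i, U i) F)
    (hA : ∀ S, adjMat F S * M = M * adjMat F S)
    (hE : ∀ S, dualIdem F x S * M = M * dualIdem F x S)
    (h0 : ∀ y z, Dst x y = univ → Dst x z = univ → M y z = 0) : M = 0 := by
  have hne : ∀ y z, Dst x y ≠ Dst x z → M y z = 0 := by
    intro y z h
    have := congrFun (congrFun (hE (Dst x y)) y) z
    unfold dualIdem at this
    rw [Matrix.mul_diagonal, Matrix.diagonal_mul] at this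
    simpa [h.symm] using this
  have main : ∀ k : ℕ, ∀ y z, (Dst x y)ᶜ.card = k → M y z = 0 := by
    intro k
    induction k with
    | zero =>
      intro y z hk
      rw [Finset.card_eq_zero, Finset.compl_eq_empty_iff] at hk
      by_cases h : Dst x y = Dst x z
      · exact h0 y z hk (h ▸ hk)
      · exact hne y z h
    | succ k ih =>
      intro y z hk
      by_cases h : Dst x y = Dst x z
      swap
      · exact hne y z h
      have hpos : 0 < (Dst x y)ᶜ.card := by omega
      obtain ⟨i, hi⟩ := Finset.card_pos.1 hpos
      have hi' : i ∉ Dst x y := by simpa using hi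
      have hyi : x i = y i := by simpa [mem_Dst'] using hi'
      have hzi : x i = z i := by rw [h] at hi'; simpa [mem_Dst'] using hi'
      have hcomm := congrFun (congrFun (hA {i}) y) (Function.update z i (a i))
      rw [Matrix.mul_apply, Matrix.mul_apply] at hcomm
      rw [Finset.sum_eq_zero, Finset.sum_eq_single z] at hcomm
      · rw [hcomm]
        have : Dst z (Function.update z i (a i)) = {i} := by
          ext j
          rw [mem_Dst', Finset.mem_singleton]
          by_cases hj : j = i
          · subst hj; simpa [← hzi] using (ha j).symm
          · simp [hj]
        simp [adjMat, this]
      · intro w _ hw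
        by_cases hD : Dst w (Function.update z i (a i)) = {i}
        · rw [hne, zero_mul]
          intro hyw
          apply hw
          funext j
          by_cases hj : j = i
          · subst hj
            rw [hyw] at hi'
            rw [← hzi]
            symm
            simpa [mem_Dst'] using hi'
          · have : j ∉ Dst w (Function.update z i (a i)) := by simp [hD, hj]
            simpa [mem_Dst', hj] using this
        · simp [adjMat, hD]
      · simp
      · intro w _
        by_cases hD : Dst y w = {i}
        · rw [ih w, mul_zero]
          have : Dst x w = insert i (Dst x y) := by
            ext j
            have hj' := congrArg (fun s => j ∈ s) hD
            simp only [mem_Dst', Finset.mem_singleton, eq_iff_iff] at hj'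
            rw [Finset.mem_insert, mem_Dst', mem_Dst']
            by_cases hj : j = i
            · subst hj
              simp only [true_or, iff_true]
              rw [hyi]; exact hj'.2 rfl
            · have : y j = w j := by
                by_contra h'; exact hj (hj'.1 h')
              simp [hj, this]
          rw [this, Finset.compl_insert, Finset.card_erase_of_mem hi, hk]
          rfl
        · simp [adjMat, hD]
  ext y z
  exact main _ y z rfl

set_option synthInstance.maxHeartbeats 1000000 in
set_option maxHeartbeats 1000000 in
theorem stmt_13 (hn : 1 ≤ n) (u : Fin n → ℕ) (hu : ∀ i, Fintype.card (U i) = u i)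
    (h2 : ∀ i, 2 ≤ u i) (x : ∀ i, U i)
    (n₂ : ℕ) (hn2 : n₂ = ((univ : Finset (Fin n)).filter (fun x => 2 < u x)).card) :
    Module.finrank F ↥(Subalgebra.center F ↥(TerwAlg F x)) = 2 ^ n₂ := by
  classical
  have hab : ∀ i, ∃ p : U i × U i, p.1 ≠ x i ∧ p.2 ≠ x i ∧ (2 < u i → p.1 ≠ p.2) := by
    intro i
    by_cases h : 2 < u i
    · have h1 : ({x i} : Finset (U i)).card < (univ : Finset (U i)).card := by
        rw [Finset.card_univ, hu i, Finset.card_singleton]; omega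
      obtain ⟨a, _, ha⟩ := Finset.exists_mem_notMem_of_card_lt_card h1
      have h1 : ({x i, a} : Finset (U i)).card < (univ : Finset (U i)).card := by
        rw [Finset.card_univ, hu i]
        exact lt_of_le_of_lt Finset.card_le_two h
      obtain ⟨b, _, hb⟩ := Finset.exists_mem_notMem_of_card_lt_card h1
      simp only [Finset.mem_insert, Finset.mem_singleton, not_or] at ha hb
      exact ⟨(a, b), ha, hb.1, fun _ => Ne.symm hb.2⟩
    · have h1 : ({x i} : Finset (U i)).card < (univ : Finset (U i)).card := by
        have := h2 i
        rw [Finset.card_univ, hu i, Finset.card_singleton]; omega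
      obtain ⟨a, _, ha⟩ := Finset.exists_mem_notMem_of_card_lt_card h1
      simp only [Finset.mem_singleton] at ha
      exact ⟨(a, a), ha, ha, fun h' => absurd h' h⟩
  choose p hp1 hp2 hp3 using hab
  let y0 : ∀ i, U i := fun i => (p i).1
  let z0 : Finset (Fin n) → ∀ i, U i := fun S i => if i ∈ S then (p i).2 else (p i).1
  set N := (univ : Finset (Fin n)).filter (fun x => 2 < u x) with hN
  have hy0 : Dst x y0 = univ := by
    ext i; simpa [mem_Dst', y0] using (hp1 i).symm
  have hz0 : ∀ S, Dst x (z0 S) = univ := by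
    intro S; ext i
    simp only [mem_Dst', z0, mem_univ, iff_true]
    split_ifs
    · exact (hp2 i).symm
    · exact (hp1 i).symm
  have hyz : ∀ S ∈ N.powerset, Dst y0 (z0 S) = S := by
    intro S hS
    rw [Finset.mem_powerset] at hS
    ext i
    simp only [mem_Dst', z0, y0]
    by_cases h : i ∈ S
    · have := hS h
      simp only [hN, Finset.mem_filter, mem_univ, true_and] at this
      simpa [h] using hp3 i this
    · simp [h]
  let φ : ↥(Subalgebra.center F ↥(TerwAlg F x)) →ₗ[F] (↥(N.powerset) → F) :=
    { toFun := fun M S => (M : ↥(TerwAlg F x)).1 y0 (z0 S.1)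
      map_add' := fun M M' => rfl
      map_smul' := fun c M => rfl }
  have hcard : Module.finrank F (↥(N.powerset) → F) = 2 ^ n₂ := by
    rw [Module.finrank_fintype_fun_eq_card, Fintype.card_coe, Finset.card_powerset, hn2]
  have hinj : Function.Injective φ := by
    rintro ⟨⟨M₁, hM₁⟩, hc₁⟩ ⟨⟨M₂, hM₂⟩, hc₂⟩ h0
    rw [Subalgebra.mem_center_iff] at hc₁ hc₂
    obtain ⟨M, hMdef⟩ : ∃ M, M = M₁ - M₂ := ⟨_, rfl⟩
    have hM : M ∈ TerwAlg F x := hMdef ▸ sub_mem hM₁ hM₂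
    have hB := InB_of_mem F x M hM
    have hcc : ∀ K ∈ TerwAlg F x, K * M = M * K := fun K hK => by
      have e1 : K * M₁ = M₁ * K := congrArg Subtype.val (hc₁ ⟨K, hK⟩)
      have e2 : K * M₂ = M₂ * K := congrArg Subtype.val (hc₂ ⟨K, hK⟩)
      rw [hMdef, mul_sub, sub_mul, e1, e2]
    have : M = 0 := by
      refine central_zero F x y0 hp1 M
        (fun S => hcc _ (Algebra.subset_adjoin (Or.inl ⟨S, rfl⟩)))
        (fun S => hcc _ (Algebra.subset_adjoin (Or.inr ⟨S, rfl⟩))) ?_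
      intro y z hy hz
      have hS : Dst y z ∈ N.powerset := by
        rw [Finset.mem_powerset]
        intro i hi
        simp only [hN, Finset.mem_filter, mem_univ, true_and]
        rw [← hu i, Fintype.two_lt_card_iff]
        have e1 : i ∈ Dst x y := by rw [hy]; exact mem_univ i
        have e2 : i ∈ Dst x z := by rw [hz]; exact mem_univ i
        rw [mem_Dst'] at e1 e2 hi
        exact ⟨x i, y i, z i, e1, e2, hi⟩
      rw [hB y z y0 (z0 (Dst y z)) (by rw [hy, hy0]) (by rw [hz, hz0]) (hyz _ hS).symm]
      rw [hMdef, Matrix.sub_apply, sub_eq_zero]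
      exact congrFun h0 ⟨Dst y z, hS⟩
    rw [hMdef, sub_eq_zero] at this
    subst this
    rfl
  have hsurj : Function.Surjective φ := by
    intro c
    let M : Matrix (∀ i, U i) (∀ i, U i) F :=
      ∑ S : ↥(N.powerset), c S • prodMat F (kS F x S.1)
    have hM : M ∈ TerwAlg F x := sum_mem fun S _ =>
      Subalgebra.smul_mem _ (mem_of_InB F x _ (kMat_InB F x S.1)) _
    have hle : TerwAlg F x ≤ Subalgebra.centralizer F {M} := by
      unfold TerwAlg
      apply Algebra.adjoin_le
      intro K hK
      rw [SetLike.mem_coe, Subalgebra.mem_centralizer_iff]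
      intro g hg
      rw [Set.mem_singleton_iff] at hg
      subst hg
      simp only [M, Finset.sum_mul, Finset.mul_sum, smul_mul_assoc, mul_smul_comm]
      refine Finset.sum_congr rfl fun S _ => ?_
      rcases hK with ⟨T, rfl⟩ | ⟨T, rfl⟩
      · rw [kMat_comm_adj]
      · rw [kMat_comm_dual]
    have hcen : (⟨M, hM⟩ : ↥(TerwAlg F x)) ∈ Subalgebra.center F ↥(TerwAlg F x) := by
      rw [Subalgebra.mem_center_iff]
      rintro ⟨K, hK⟩
      apply Subtype.ext
      have := hle hK
      rw [Subalgebra.mem_centralizer_iff] at this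
      exact (this M rfl).symm
    refine ⟨⟨⟨M, hM⟩, hcen⟩, ?_⟩
    funext R
    change M y0 (z0 R.1) = c R
    have hent : ∀ S : ↥(N.powerset), prodMat F (kS F x S.1) y0 (z0 R.1)
        = if S = R then 1 else 0 := by
      intro S
      unfold prodMat
      have : ∀ i, kS F x S.1 i (y0 i) (z0 R.1 i) = if (i ∈ S.1 ↔ i ∈ R.1) then 1 else 0 := by
        intro i
        have hi : i ∈ R.1 ↔ y0 i ≠ z0 R.1 i := by
          rw [← mem_Dst', hyz _ R.2]
        have e1 : z0 R.1 i ≠ x i := by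
          have : i ∈ Dst x (z0 R.1) := by rw [hz0]; exact mem_univ i
          rw [mem_Dst'] at this
          exact this.symm
        have e2 : y0 i ≠ x i := hp1 i
        simp only [hi]
        unfold kS
        by_cases h : i ∈ S.1
        · simp [h, kOne, e1, e2]
        · simp [h, Matrix.one_apply]
      simp only [this, Finset.prod_ite_zero, Finset.prod_const_one, mem_univ, true_imp_iff]
      simp only [Subtype.ext_iff, Finset.ext_iff]
    simp only [M, Matrix.sum_apply, Matrix.smul_apply, hent]
    simp
  rw [← hcard]
  exact LinearEquiv.finrank_eq (LinearEquiv.ofBijective φ ⟨hinj, hsurj⟩)
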